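/- Let m ≥ 2 and n ≥ 1, let X_0, …, X_{m-1} be invertible real n×n matrices, and let B_a, B_b be real n×n matrices. Set Y_j := -X_j for j = 0, …, m-2. Let M be the mn×mn block matrix whose (j,j) block is Y_j and (j,j+1) block is I_n for j = 0, …, m-2, whose (m-1,0) block is B_a, whose (m-1,m-1) block is B_b X_{m-1}, and whose remaining blocks are zero. Then M is invertible if and only if N := B_a + B_b X_{m-1} X_{m-2} ⋯ X_0 is invertible. -/

import Mathlib

open Matrix

theorem Matrix.isUnit_iff_forall_mulVec_eq_zero {ι K : Type*} [Fintype ι] [DecidableEq ι]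
    [Field K] (A : Matrix ι ι K) : IsUnit A ↔ ∀ v, A *ᵥ v = 0 → v = 0 := by
  rw [Matrix.isUnit_iff_isUnit_det, isUnit_iff_ne_zero, ne_eq,
    ← Matrix.exists_mulVec_eq_zero_iff]
  push Not
  exact forall_congr' fun v => not_imp_not

theorem List.prod_reverse_map_range_succ {R : Type*} [Monoid R] (X : ℕ → R) (k : ℕ) :
    (((List.range (k + 1)).map X).reverse).prod =
      X k * (((List.range k).map X).reverse).prod := by
  simp [List.range_succ]

/-- The multiple shooting matrix `M` is invertible if and only if
`N = Ba + Bb * X (m-1) * ⋯ * X 0` is invertible. -/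
theorem M_isUnit_iff_N_isUnit (m n : ℕ) (hm : 2 ≤ m) (hn : 1 ≤ n)
    (X : ℕ → Matrix (Fin n) (Fin n) ℝ)
    (hX : ∀ k < m, IsUnit (X k))
    (Ba Bb : Matrix (Fin n) (Fin n) ℝ)
    (Y : ℕ → Matrix (Fin n) (Fin n) ℝ)
    (hY : ∀ j, Y j = -(X j))
    (M : Matrix (Fin m × Fin n) (Fin m × Fin n) ℝ)
    (hM : ∀ p q : Fin m × Fin n,
      M p q =
        if (p.1 : ℕ) = m - 1 then
          (if (q.1 : ℕ) = 0 then Ba p.2 q.2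
           else if (q.1 : ℕ) = m - 1 then (Bb * X (m - 1)) p.2 q.2
           else 0)
        else if (p.1 : ℕ) = (q.1 : ℕ) then Y (p.1 : ℕ) p.2 q.2
        else if (p.1 : ℕ) + 1 = (q.1 : ℕ) then (1 : Matrix (Fin n) (Fin n) ℝ) p.2 q.2
        else 0) :
    IsUnit M ↔ IsUnit (Ba + Bb * (((List.range m).map X).reverse).prod) := by
  obtain ⟨l, rfl⟩ : ∃ l, m = l + 1 := ⟨m - 1, by omega⟩
  simp only [Nat.add_sub_cancel] at hM
  have row_castSucc (v : Fin (l + 1) × Fin n → ℝ) (j : Fin l) (i : Fin n) :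
      (M *ᵥ v) (j.castSucc, i) =
        v (j.succ, i) - (X j *ᵥ fun b => v (j.castSucc, b)) i := by
    have hj : (j : ℕ) ≠ l := j.2.ne
    rw [mulVec, dotProduct, Fintype.sum_prod_type,
      Fintype.sum_eq_add j.castSucc j.succ (Fin.castSucc_lt_succ).ne]
    · simp [hM, hj, hY, mulVec, dotProduct, Matrix.one_apply]
      ring
    · rintro a ⟨h₁, h₂⟩
      have h₁' : (j : ℕ) ≠ a := fun h => h₁ (Fin.ext h.symm)
      have h₂' : (j : ℕ) + 1 ≠ a := fun h => h₂ (Fin.ext h.symm)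
      simp [hM, hj, h₁', h₂']
  have row_last (v : Fin (l + 1) × Fin n → ℝ) (i : Fin n) :
      (M *ᵥ v) (Fin.last l, i) =
        (Ba *ᵥ fun b => v (0, b)) i + ((Bb * X l) *ᵥ fun b => v (Fin.last l, b)) i := by
    have hl : l ≠ 0 := by omega
    rw [mulVec, dotProduct, Fintype.sum_prod_type, Fintype.sum_eq_add 0 (Fin.last l)]
    · simp [hM, hl, mulVec, dotProduct]
    · exact fun h => hl (congrArg Fin.val h).symm
    · rintro a ⟨h₁, h₂⟩
      have h₁' : (a : ℕ) ≠ 0 := fun h => h₁ (Fin.ext h)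
      have h₂' : (a : ℕ) ≠ l := fun h => h₂ (Fin.ext h)
      simp only [hM, Fin.val_last, h₁', h₂', if_true, if_false, zero_mul, Finset.sum_const_zero]
  set P : ℕ → Matrix (Fin n) (Fin n) ℝ :=
    fun k => (((List.range k).map X).reverse).prod with hP
  have P_zero : P 0 = 1 := by simp [hP]
  have P_succ (k : ℕ) : P (k + 1) = X k * P k := List.prod_reverse_map_range_succ X k
  change _ ↔ IsUnit (Ba + Bb * P (l + 1))
  rw [Matrix.isUnit_iff_forall_mulVec_eq_zero, Matrix.isUnit_iff_forall_mulVec_eq_zero, P_succ]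
  constructor
  · intro h u hu
    have hv := h (fun p => (P p.1 *ᵥ u) p.2) (by
      ext ⟨j, i⟩
      induction j using Fin.lastCases with
      | last =>
        rw [row_last]
        simpa [P_zero, add_mulVec, Matrix.mul_assoc] using congrFun hu i
      | cast j =>
        rw [row_castSucc]
        simp [P_succ])
    ext i
    simpa [P_zero] using congrFun hv (0, i)
  · intro h v hv
    have hprop (j : Fin (l + 1)) : (fun b => v (j, b)) = P j *ᵥ fun b => v (0, b) := by
      induction j using Fin.induction with
      | zero => simp [P_zero]
      | succ j ih =>
        ext i
        have hij := congrFun hv (j.castSucc, i)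
        rw [row_castSucc, ih, Pi.zero_apply, sub_eq_zero] at hij
        simpa [P_succ] using hij
    have h0 : (fun b => v (0, b)) = 0 := h _ (by
      ext i
      have hi := congrFun hv (Fin.last l, i)
      rw [row_last, hprop (Fin.last l)] at hi
      simpa [add_mulVec, Matrix.mul_assoc] using hi)
    ext ⟨j, i⟩
    simpa [h0] using congrFun (hprop j) i
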